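/- Busemann's theorem for convex measures: let κ ∈ [−∞, 1/d] and let X be a random vector in ℝ^d whose distribution is symmetric (invariant under x ↦ −x) and κ-concave. Then for all u, v ∈ ℝ^d, N_∞^{1/2}(⟨u+v, X⟩) ≤ N_∞^{1/2}(⟨u, X⟩) + N_∞^{1/2}(⟨v, X⟩); consequently the function M(v) = N_∞^{1/2}(⟨v, X⟩) for v ≠ 0, M(0) = 0, defines a norm on ℝ^d. -/

import Mathlib

open MeasureTheory ProbabilityTheory Real
open scoped ENNReal Pointwise Classical

noncomputable section

/-- The real-valued random variable `X` has density `f` with respect to Lebesgue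
measure on `ℝ`. -/
def HasDensityFn1 {Ω : Type*} [MeasurableSpace Ω]
    (P : Measure Ω) (X : Ω → ℝ) (f : ℝ → ℝ) : Prop :=
  Measurable X ∧ Measurable f ∧ (∀ x, 0 ≤ f x) ∧
    Measure.map X P = volume.withDensity (fun x => ENNReal.ofReal (f x))

/-- `N_∞^{1/2}(f) = 1/‖f‖_∞ = exp(h_∞(f))`, where `‖f‖_∞` is the essential supremum
of the density. -/
def sqrtInfRenyiPower1 (f : ℝ → ℝ) : ℝ :=
  Real.exp (-Real.log ((eLpNorm f ⊤ volume).toReal))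

/-- The generalized `κ`-mean `M_κ^t(a,b)` for `κ ∈ [-∞, ∞]`. -/
def genMean (κ : EReal) (t a b : ℝ) : ℝ :=
  if κ = ⊥ then min a b
  else if κ = ⊤ then max a b
  else if κ = 0 then a ^ (1 - t) * b ^ t
  else if κ.toReal < 0 ∧ (a = 0 ∨ b = 0) then 0
  else ((1 - t) * a ^ κ.toReal + t * b ^ κ.toReal) ^ (1 / κ.toReal)

/-- A measure `μ` on a real topological vector space is `κ`-concave in the sense of
Borell: its support has nonempty interior and
`μ((1-t)A + tB) ≥ M_κ^t(μ(A), μ(B))` for all Borel `A, B` and `t ∈ [0,1]`. -/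
def IsKappaConcave {E : Type*} [AddCommGroup E] [Module ℝ E] [TopologicalSpace E]
    [MeasurableSpace E] (κ : EReal) (μ : Measure E) : Prop :=
  (interior {x : E | ∀ U ∈ nhds x, 0 < μ U}).Nonempty ∧
    ∀ A B : Set E, MeasurableSet A → MeasurableSet B → ∀ t : ℝ, t ∈ Set.Icc (0:ℝ) 1 →
      genMean κ t (μ A).toReal (μ B).toReal ≤ (μ ((1 - t) • A + t • B)).toReal


/-- level parametrisation -/
def bzLev (n : ℕ) (a : ℝ) : ℝ≥0∞ := ENNReal.ofReal (1 / a ^ n)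

lemma bz_vol_add {A B C : Set ℝ} (hA : A.Nonempty) (hB : B.Nonempty) (hC : C.OrdConnected)
    (hABC : ∀ a ∈ A, ∀ b ∈ B, a + b ∈ C) : volume A + volume B ≤ volume C := by
  have key : ∀ a₁ ∈ A, ∀ a₂ ∈ A, ∀ b₁ ∈ B, ∀ b₂ ∈ B, edist a₁ a₂ + edist b₁ b₂ ≤ volume C := by
    have main : ∀ a₁ ∈ A, ∀ a₂ ∈ A, ∀ b₁ ∈ B, ∀ b₂ ∈ B, a₁ ≤ a₂ → b₁ ≤ b₂ →
        edist a₁ a₂ + edist b₁ b₂ ≤ volume C := by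
      intro a₁ h1 a₂ h2 b₁ h3 b₂ h4 h5 h6
      have : Set.Icc (a₁ + b₁) (a₂ + b₂) ⊆ C := hC.out (hABC _ h1 _ h3) (hABC _ h2 _ h4)
      refine le_trans (le_of_eq ?_) (measure_mono this)
      rw [Real.volume_Icc, edist_comm a₁, edist_comm b₁, edist_dist, edist_dist, Real.dist_eq,
        Real.dist_eq, abs_of_nonneg (by linarith), abs_of_nonneg (by linarith),
        ← ENNReal.ofReal_add (by linarith) (by linarith)]
      congr 1; ring
    intro a₁ h1 a₂ h2 b₁ h3 b₂ h4
    rcases le_total a₁ a₂ with h5 | h5 <;> rcases le_total b₁ b₂ with h6 | h6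
    · exact main _ h1 _ h2 _ h3 _ h4 h5 h6
    · rw [edist_comm b₁]; exact main _ h1 _ h2 _ h4 _ h3 h5 h6
    · rw [edist_comm a₁]; exact main _ h2 _ h1 _ h3 _ h4 h5 h6
    · rw [edist_comm b₁, edist_comm a₁]; exact main _ h2 _ h1 _ h4 _ h3 h5 h6
  obtain ⟨a0, ha0⟩ := hA
  obtain ⟨b0, hb0⟩ := hB
  by_cases hCt : volume C = ⊤
  · rw [hCt]; exact le_top
  have hAd : ∀ b₁ ∈ B, ∀ b₂ ∈ B, Metric.ediam A + edist b₁ b₂ ≤ volume C := by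
    intro b₁ h3 b₂ h4
    have hfin : edist b₁ b₂ ≤ volume C := le_trans le_add_self (key a0 ha0 a0 ha0 b₁ h3 b₂ h4)
    have : Metric.ediam A ≤ volume C - edist b₁ b₂ := by
      refine Metric.ediam_le ?_
      intro a₁ h1 a₂ h2
      exact ENNReal.le_sub_of_add_le_right (edist_ne_top _ _) (key _ h1 _ h2 _ h3 _ h4)
    calc _ ≤ (volume C - edist b₁ b₂) + edist b₁ b₂ := by gcongr
      _ = _ := tsub_add_cancel_of_le hfin
  have hAf : Metric.ediam A ≤ volume C := le_trans le_self_add (hAd b0 hb0 b0 hb0)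
  have hB2 : Metric.ediam B ≤ volume C - Metric.ediam A := by
    refine Metric.ediam_le ?_
    intro b₁ h3 b₂ h4
    exact ENNReal.le_sub_of_add_le_left (ne_top_of_le_ne_top hCt hAf) (hAd _ h3 _ h4)
  calc volume A + volume B ≤ Metric.ediam A + Metric.ediam B :=
        add_le_add (Real.volume_le_diam _) (Real.volume_le_diam _)
    _ ≤ Metric.ediam A + (volume C - Metric.ediam A) := by gcongr
    _ = _ := add_tsub_cancel_of_le hAf

lemma bz_layer {f : ℝ → ℝ≥0∞} (hf : Measurable f) {A : ℝ≥0∞} (hA : A ≠ 0) (hA' : A ≠ ⊤) :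
    ∫⁻ x, min (f x) A / A = ∫⁻ t in Set.Ioc (0:ℝ) 1, volume {x | ENNReal.ofReal t * A ≤ f x} := by
  have hle : ∀ x, min (f x) A / A ≤ 1 := fun x =>
    ENNReal.div_le_of_le_mul (by simp)
  have hne : ∀ x, min (f x) A / A ≠ ⊤ := fun x => ne_top_of_le_ne_top ENNReal.one_ne_top (hle x)
  have h1 : ∫⁻ x, min (f x) A / A = ∫⁻ x, ENNReal.ofReal ((min (f x) A / A).toReal) := by
    refine lintegral_congr fun x => ?_
    rw [ENNReal.ofReal_toReal (hne x)]
  rw [h1, lintegral_eq_lintegral_meas_le volume (Filter.Eventually.of_forall fun x => ENNReal.toReal_nonneg)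
    (by fun_prop)]
  rw [← Set.Ioc_union_Ioi_eq_Ioi (zero_le_one (α := ℝ)),
    lintegral_union measurableSet_Ioi (by
      rw [Set.disjoint_left]; intro x hx hx'; exact absurd hx.2 (not_le.2 hx'))]
  have h2 : ∫⁻ t in Set.Ioi (1:ℝ), volume {a | t ≤ (min (f a) A / A).toReal} = 0 := by
    rw [← lintegral_zero (μ := volume.restrict (Set.Ioi (1:ℝ)))]
    refine setLIntegral_congr_fun measurableSet_Ioi ?_
    intro t ht
    have : {a | t ≤ (min (f a) A / A).toReal} = ∅ := by
      ext a
      simp only [Set.mem_ofPred_eq, Set.mem_empty_iff_false, iff_false, not_le]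
      refine lt_of_le_of_lt ?_ ht
      have := ENNReal.toReal_mono ENNReal.one_ne_top (hle a)
      simpa using this
    show volume {a | t ≤ (min (f a) A / A).toReal} = 0
    rw [this, measure_empty]
  rw [h2, add_zero]
  refine setLIntegral_congr_fun measurableSet_Ioc ?_
  intro t ht
  simp only
  congr 1
  ext a
  simp only [Set.mem_ofPred_eq]
  rw [← ENNReal.ofReal_le_iff_le_toReal (hne a), ENNReal.le_div_iff_mul_le (Or.inl hA) (Or.inl hA'),
    le_min_iff]
  constructor
  · exact fun h => h.1
  · intro h
    refine ⟨h, ?_⟩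
    calc ENNReal.ofReal t * A ≤ 1 * A := by
          gcongr
          exact ENNReal.ofReal_le_one.2 ht.2
      _ = A := one_mul _

lemma bz_lev_sqrt {t a : ℝ} (ht : 0 < t) : ENNReal.ofReal t * bzLev 2 a = bzLev 2 (a / √t) := by
  unfold bzLev
  rw [← ENNReal.ofReal_mul ht.le]
  congr 1
  rw [div_pow, Real.sq_sqrt ht.le]
  field_simp

lemma bz_exists_lev {A : ℝ≥0∞} (hA : A ≠ 0) (hA' : A ≠ ⊤) : ∃ a : ℝ, 0 < a ∧ bzLev 2 a = A := by
  have h0 : 0 < A.toReal := ENNReal.toReal_pos hA hA'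
  refine ⟨1 / √A.toReal, by positivity, ?_⟩
  unfold bzLev
  rw [div_pow, Real.sq_sqrt h0.le]
  simp [ENNReal.ofReal_toReal hA']

lemma bz_bbl1 {f g h : ℝ → ℝ≥0∞} (hf : Measurable f) (hg : Measurable g) (hh : Measurable h)
    (hoc : ∀ a > 0, Set.OrdConnected {x | bzLev 2 a ≤ h x})
    (H : ∀ x y a b : ℝ, 0 < a → 0 < b → bzLev 2 a ≤ f x → bzLev 2 b ≤ g y →
      bzLev 2 (a + b) ≤ h (x + y))
    {α β : ℝ} (hα : 0 < α) (hβ : 0 < β) (hfx : ∃ x, bzLev 2 α ≤ f x) (hgx : ∃ y, bzLev 2 β ≤ g y) :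
    (∫⁻ x, h x)⁻¹ ≤ (∫⁻ x, min (f x) (bzLev 2 α))⁻¹ + (∫⁻ x, min (g x) (bzLev 2 β))⁻¹ := by
  obtain ⟨x0, hx0⟩ := hfx
  obtain ⟨y0, hy0⟩ := hgx
  have lev0 : ∀ a : ℝ, 0 < a → bzLev 2 a ≠ 0 := by
    intro a ha; unfold bzLev; simp; positivity
  have levt : ∀ a : ℝ, bzLev 2 a ≠ ⊤ := fun a => ENNReal.ofReal_ne_top
  have h1 : (∫⁻ x, min (f x) (bzLev 2 α) / bzLev 2 α) + (∫⁻ x, min (g x) (bzLev 2 β) / bzLev 2 β)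
      ≤ ∫⁻ x, min (h x) (bzLev 2 (α + β)) / bzLev 2 (α + β) := by
    rw [bz_layer hf (lev0 _ hα) (levt _), bz_layer hg (lev0 _ hβ) (levt _),
      bz_layer hh (lev0 _ (by positivity)) (levt _)]
    have hle : ∀ t ∈ Set.Ioc (0:ℝ) 1, ∀ A : ℝ≥0∞, ENNReal.ofReal t * A ≤ A := by
      intro t ht A
      calc ENNReal.ofReal t * A ≤ 1 * A := by
            gcongr
            exact ENNReal.ofReal_le_one.2 ht.2
        _ = A := one_mul _
    rw [← lintegral_add_left']
    · refine setLIntegral_mono_ae' measurableSet_Ioc (Filter.Eventually.of_forall fun t ht => ?_)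
      refine bz_vol_add ⟨x0, (hle t ht _).trans hx0⟩ ⟨y0, (hle t ht _).trans hy0⟩ ?_ ?_
      · rw [bz_lev_sqrt ht.1]
        exact hoc _ (div_pos (by positivity) (Real.sqrt_pos.2 ht.1))
      · intro a ha b hb
        have hs := Real.sqrt_pos.2 ht.1
        simp only [Set.mem_ofPred_eq] at *
        rw [bz_lev_sqrt ht.1] at *
        rw [add_div]
        exact H _ _ _ _ (div_pos hα hs) (div_pos hβ hs) ha hb
    · have : Antitone (fun t : ℝ => volume {x | ENNReal.ofReal t * bzLev 2 α ≤ f x}) := by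
        intro s t hst
        refine measure_mono ?_
        intro x hx
        simp only [Set.mem_ofPred_eq] at *
        exact le_trans (by gcongr) hx
      exact this.measurable.aemeasurable
  set I := ∫⁻ x, min (f x) (bzLev 2 α) with hI
  set J := ∫⁻ x, min (g x) (bzLev 2 β) with hJ
  have hdiv : ∀ (k : ℝ → ℝ≥0∞) (A : ℝ≥0∞), A ≠ 0 → ∫⁻ x, k x / A = (∫⁻ x, k x) / A := by
    intro k A hA
    simp_rw [div_eq_mul_inv]
    rw [lintegral_mul_const' _ _ (by simpa using hA)]
  rw [hdiv _ _ (lev0 _ hα), hdiv _ _ (lev0 _ hβ), hdiv _ _ (lev0 _ (by positivity)), ← hI, ← hJ] at h1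
  have h2 : (I / bzLev 2 α + J / bzLev 2 β) * bzLev 2 (α + β) ≤ ∫⁻ x, h x := by
    rw [← ENNReal.le_div_iff_mul_le (Or.inl (lev0 _ (by positivity))) (Or.inl (levt _))]
    refine h1.trans ?_
    gcongr
    exact min_le_left _ _
  rcases eq_or_ne I 0 with hI0 | hI0
  · simp [hI0]
  rcases eq_or_ne J 0 with hJ0 | hJ0
  · simp [hJ0]
  rcases eq_or_ne I ⊤ with hIt | hIt
  · rw [hIt, ENNReal.top_div_of_ne_top (levt _), top_add, ENNReal.top_mul (lev0 _ (by positivity)), top_le_iff] at h2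
    simp [h2]
  rcases eq_or_ne J ⊤ with hJt | hJt
  · rw [hJt, ENNReal.top_div_of_ne_top (levt _), add_top, ENNReal.top_mul (lev0 _ (by positivity)), top_le_iff] at h2
    simp [h2]
  refine (ENNReal.inv_le_inv.2 h2).trans ?_
  have hIp := ENNReal.toReal_pos hI0 hIt
  have hJp := ENNReal.toReal_pos hJ0 hJt
  rw [← ENNReal.ofReal_toReal hIt, ← ENNReal.ofReal_toReal hJt]
  generalize I.toReal = i at *
  generalize J.toReal = j at *
  unfold bzLev
  rw [← ENNReal.ofReal_div_of_pos (by positivity), ← ENNReal.ofReal_div_of_pos (by positivity),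
    ← ENNReal.ofReal_add (by positivity) (by positivity), ← ENNReal.ofReal_mul (by positivity),
    ← ENNReal.ofReal_inv_of_pos (by positivity), ← ENNReal.ofReal_inv_of_pos (by positivity),
    ← ENNReal.ofReal_inv_of_pos (by positivity), ← ENNReal.ofReal_add (by positivity) (by positivity)]
  apply ENNReal.ofReal_le_ofReal
  have e1 : ((i / (1 / α ^ 2) + j / (1 / β ^ 2)) * (1 / (α + β) ^ 2))⁻¹
      = (α + β) ^ 2 / (i * α ^ 2 + j * β ^ 2) := by field_simp
  have e2 : i⁻¹ + j⁻¹ = (i + j) / (i * j) := by field_simp; ring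
  rw [e1, e2, div_le_div_iff₀ (by positivity) (by positivity)]
  nlinarith [sq_nonneg (i * α - j * β)]

lemma bz_approx {f : ℝ → ℝ≥0∞} (hf : Measurable f) (h0 : ∫⁻ x, f x ≠ 0) :
    ∃ α : ℕ → ℝ, (∀ n, 0 < α n) ∧ (∀ n, ∃ x, bzLev 2 (α n) ≤ f x) ∧
      Filter.Tendsto (fun n => ∫⁻ x, min (f x) (bzLev 2 (α n))) Filter.atTop (nhds (∫⁻ x, f x)) := by
  have hs : 0 < ⨆ x, f x := by
    rw [pos_iff_ne_zero]
    intro hs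
    apply h0
    have : ∀ x, f x = 0 := by simpa using hs
    simp [this]
  obtain ⟨A, hAm, hA, hAt⟩ := exists_seq_strictMono_tendsto' hs
  have hAne : ∀ n, A n ≠ ⊤ := fun n => ((hA n).2.trans_le le_top).ne
  choose α hα hαA using fun n => bz_exists_lev (hA n).1.ne' (hAne n)
  refine ⟨α, hα, fun n => ?_, ?_⟩
  · rw [hαA]
    obtain ⟨x, hx⟩ := lt_iSup_iff.1 (hA n).2
    exact ⟨x, hx.le⟩
  · simp_rw [hαA]
    refine lintegral_tendsto_of_tendsto_of_monotone (fun n => (hf.min measurable_const).aemeasurable)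
      (Filter.Eventually.of_forall fun x n m hnm => min_le_min le_rfl (hAm.monotone hnm))
      (Filter.Eventually.of_forall fun x => ?_)
    have := (tendsto_const_nhds (x := f x)).min hAt
    rwa [min_eq_left (le_iSup f x)] at this

lemma bz_bbl {f g h : ℝ → ℝ≥0∞} (hf : Measurable f) (hg : Measurable g) (hh : Measurable h)
    (hoc : ∀ a > 0, Set.OrdConnected {x | bzLev 2 a ≤ h x})
    (H : ∀ x y a b : ℝ, 0 < a → 0 < b → bzLev 2 a ≤ f x → bzLev 2 b ≤ g y →
      bzLev 2 (a + b) ≤ h (x + y)) :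
    (∫⁻ x, h x)⁻¹ ≤ (∫⁻ x, f x)⁻¹ + (∫⁻ x, g x)⁻¹ := by
  rcases eq_or_ne (∫⁻ x, f x) 0 with hI0 | hI0
  · simp [hI0]
  rcases eq_or_ne (∫⁻ x, g x) 0 with hJ0 | hJ0
  · simp [hJ0]
  obtain ⟨α, ha, hax, hat⟩ := bz_approx hf hI0
  obtain ⟨β, hb, hbx, hbt⟩ := bz_approx hg hJ0
  refine ge_of_tendsto' ((tendsto_inv_iff.2 hat).add (tendsto_inv_iff.2 hbt)) fun n => ?_
  exact bz_bbl1 hf hg hh hoc H (ha n) (hb n) (hax n) (hbx n)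

lemma bz_meas {f : ℝ → ℝ≥0∞} (hoc : ∀ a > 0, Set.OrdConnected {x | bzLev 2 a ≤ f x}) :
    Measurable f := by
  refine measurable_of_Ioi fun c => ?_
  refine Set.OrdConnected.measurableSet ?_
  constructor
  intro x hx y hy z hz
  simp only [Set.mem_preimage, Set.mem_Ioi] at *
  obtain ⟨r, hr1, hr2⟩ := ENNReal.lt_iff_exists_nnreal_btwn.1 (lt_min hx hy)
  obtain ⟨a, ha, har⟩ := bz_exists_lev (A := r) (ne_bot_of_gt hr1) ENNReal.coe_ne_top
  have := (hoc a ha).out (x := x) (y := y) (by simp [har, (hr2.trans_le (min_le_left _ _)).le])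
    (by simp [har, (hr2.trans_le (min_le_right _ _)).le]) hz
  simp only [Set.mem_ofPred_eq, har] at this
  exact hr1.trans_le this


/-- `Q ^ (-1/n)` is convex. -/
def BzConv {E : Type*} [AddCommGroup E] [Module ℝ E] (n : ℕ) (Q : E → ℝ≥0∞) : Prop :=
  ∀ p q : E, ∀ s t a b : ℝ, 0 < s → 0 < t → s + t = 1 → 0 < a → 0 < b →
    bzLev n a ≤ Q p → bzLev n b ≤ Q q → bzLev n (s * a + t * b) ≤ Q (s • p + t • q)

lemma bz_lev_div {a s : ℝ} {y : ℝ≥0∞} (hs : 0 < s) :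
    bzLev 2 a ≤ ENNReal.ofReal (1 / s ^ 2) * y ↔ bzLev 2 (a / s) ≤ y := by
  have h : bzLev 2 (a / s) = bzLev 2 a / ENNReal.ofReal (1 / s ^ 2) := by
    unfold bzLev
    rw [← ENNReal.ofReal_div_of_pos (by positivity)]
    congr 1
    field_simp
  rw [h, ENNReal.div_le_iff_le_mul (Or.inl (by simp; positivity)) (Or.inl ENNReal.ofReal_ne_top), mul_comm]

lemma bz_slice_oc {E : Type*} [AddCommGroup E] [Module ℝ E] {Q : E → ℝ≥0∞} (hQ : BzConv 2 Q)
    (p e : E) : ∀ a > 0, Set.OrdConnected {r : ℝ | bzLev 2 a ≤ Q (p + r • e)} := by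
  intro a ha
  refine Convex.ordConnected (convex_iff_forall_pos.2 ?_)
  intro x hx y hy s t hs ht hst
  have := hQ _ _ s t a a hs ht hst ha ha hx hy
  simp only [Set.mem_ofPred_eq]
  have e1 : s * a + t * a = a := by rw [← add_mul, hst, one_mul]
  have e2 : s • (p + x • e) + t • (p + y • e) = p + (s • x + t • y) • e := by
    have : p = (s + t) • p := by rw [hst, one_smul]
    nth_rewrite 3 [this]
    simp only [smul_eq_mul]
    module
  rwa [e1, e2] at this

lemma bz_slice_meas {E : Type*} [AddCommGroup E] [Module ℝ E] {Q : E → ℝ≥0∞} (hQ : BzConv 2 Q)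
    (p e : E) : Measurable fun r : ℝ => Q (p + r • e) := bz_meas (bz_slice_oc hQ p e)

lemma bz_slice2 {Q : ℝ × ℝ → ℝ≥0∞} (σ : ℝ) : (fun r : ℝ => Q ((σ, 0) + r • (0, 1))) = fun r => Q (σ, r) := by
  ext r; simp

lemma bz_slice2_meas {Q : ℝ × ℝ → ℝ≥0∞} (hQ : BzConv 2 Q) (σ : ℝ) : Measurable fun r : ℝ => Q (σ, r) := by
  rw [← bz_slice2]; exact bz_slice_meas hQ _ _

lemma bz_lint_scale {f : ℝ → ℝ≥0∞} (hf : Measurable f) {s : ℝ} (hs : 0 < s) :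
    ∫⁻ x, ENNReal.ofReal (1 / s ^ 2) * f (s⁻¹ * x) = ENNReal.ofReal (1 / s) * ∫⁻ x, f x := by
  rw [lintegral_const_mul _ (by fun_prop), ← lintegral_map (f := f) hf (by fun_prop),
    Real.map_volume_mul_left (by positivity), lintegral_smul_measure, inv_inv, abs_of_pos hs,
    smul_eq_mul, ← mul_assoc, ← ENNReal.ofReal_mul (by positivity)]
  congr 2
  field_simp

lemma bz_gconv {Q : ℝ × ℝ → ℝ≥0∞} (hQ : BzConv 2 Q) {s t : ℝ} (hs : 0 < s) (ht : 0 < t)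
    (hst : s + t = 1) (σ τ : ℝ) :
    (∫⁻ y, Q (s * σ + t * τ, y))⁻¹ ≤
      ENNReal.ofReal s * (∫⁻ y, Q (σ, y))⁻¹ + ENNReal.ofReal t * (∫⁻ y, Q (τ, y))⁻¹ := by
  have hm := bz_slice2_meas hQ
  have := bz_bbl (f := fun x => ENNReal.ofReal (1 / s ^ 2) * Q (σ, s⁻¹ * x))
    (g := fun x => ENNReal.ofReal (1 / t ^ 2) * Q (τ, t⁻¹ * x))
    (h := fun x => Q (s * σ + t * τ, x))
    (((hm σ).comp (measurable_const_mul _)).const_mul _)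
    (((hm τ).comp (measurable_const_mul _)).const_mul _) (hm _)
    (by simpa using bz_slice_oc hQ (s * σ + t * τ, 0) (0, 1))
    (by
      intro x y a b ha hb h1 h2
      rw [bz_lev_div hs] at h1
      rw [bz_lev_div ht] at h2
      have := hQ _ _ s t _ _ hs ht hst (div_pos ha hs) (div_pos hb ht) h1 h2
      have e1 : s * (a / s) + t * (b / t) = a + b := by field_simp
      have e2 : s • (σ, s⁻¹ * x) + t • (τ, t⁻¹ * y) = (s * σ + t * τ, x + y) := by
        ext
        · simp
        · simp; field_simp
      rwa [e1, e2] at this)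
  rw [bz_lint_scale (hm σ) hs, bz_lint_scale (hm τ) ht] at this
  refine this.trans (le_of_eq ?_)
  have h : ∀ r : ℝ, 0 < r → ∀ y : ℝ≥0∞, (ENNReal.ofReal (1 / r) * y)⁻¹ = ENNReal.ofReal r * y⁻¹ := by
    intro r hr y
    rw [ENNReal.mul_inv (Or.inl (by simp; positivity)) (Or.inl ENNReal.ofReal_ne_top), 
      ← ENNReal.ofReal_inv_of_pos (by positivity), one_div, inv_inv]
  rw [h s hs, h t ht]

lemma bz_persp_int {f : ℝ → ℝ≥0∞} :
    ∫⁻ ρ, (if 0 < ρ then ENNReal.ofReal (1 / ρ ^ 2) * f ρ⁻¹ else 0) = ∫⁻ r in Set.Ioi (0:ℝ), f r := by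
  have h1 : (Inv.inv '' Set.Ioi (0:ℝ)) = Set.Ioi (0:ℝ) := by
    ext x; simp
  have := lintegral_image_eq_lintegral_abs_deriv_mul (s := Set.Ioi (0:ℝ)) (f := fun x => x⁻¹)
    (f' := fun x => -(x ^ 2)⁻¹) measurableSet_Ioi
    (fun x hx => (hasDerivAt_inv (ne_of_gt hx)).hasDerivWithinAt) inv_injective.injOn f
  have h1' : ((fun x : ℝ => x⁻¹) '' Set.Ioi (0:ℝ)) = Set.Ioi (0:ℝ) := h1
  rw [h1'] at this
  rw [this, ← lintegral_indicator measurableSet_Ioi]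
  refine lintegral_congr fun x => ?_
  by_cases hx : 0 < x
  · rw [if_pos hx, Set.indicator_of_mem (Set.mem_Ioi.2 hx), abs_neg, abs_of_pos (by positivity), one_div]
  · rw [if_neg hx, Set.indicator_of_notMem (by simpa using hx)]

lemma bz_persp {Q : ℝ × ℝ → ℝ≥0∞} (hQ : BzConv 2 Q) {e₁ e₂ : ℝ × ℝ} {ρ τ a b : ℝ}
    (ha : 0 < a) (hb : 0 < b)
    (h1 : bzLev 2 a ≤ (if 0 < ρ then ENNReal.ofReal (1 / ρ ^ 2) * Q (ρ⁻¹ • e₁) else 0))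
    (h2 : bzLev 2 b ≤ (if 0 < τ then ENNReal.ofReal (1 / τ ^ 2) * Q (τ⁻¹ • e₂) else 0)) :
    bzLev 2 (a + b) ≤ (if 0 < ρ + τ then ENNReal.ofReal (1 / (ρ + τ) ^ 2) * Q ((ρ + τ)⁻¹ • (e₁ + e₂)) else 0) := by
  have lev0 : ∀ a : ℝ, 0 < a → ¬ bzLev 2 a ≤ 0 := by
    intro a ha; unfold bzLev; simp; positivity
  by_cases hρ : 0 < ρ
  swap
  · rw [if_neg hρ] at h1; exact absurd h1 (lev0 a ha)
  by_cases hτ : 0 < τ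
  swap
  · rw [if_neg hτ] at h2; exact absurd h2 (lev0 b hb)
  have hρτ : 0 < ρ + τ := by positivity
  rw [if_pos hρ, bz_lev_div hρ] at h1
  rw [if_pos hτ, bz_lev_div hτ] at h2
  rw [if_pos hρτ, bz_lev_div hρτ]
  have := hQ _ _ (ρ / (ρ + τ)) (τ / (ρ + τ)) _ _ (by positivity) (by positivity) (by field_simp)
    (div_pos ha hρ) (div_pos hb hτ) h1 h2
  have e1 : ρ / (ρ + τ) * (a / ρ) + τ / (ρ + τ) * (b / τ) = (a + b) / (ρ + τ) := by field_simp
  have e2 : (ρ / (ρ + τ)) • ρ⁻¹ • e₁ + (τ / (ρ + τ)) • τ⁻¹ • e₂ = (ρ + τ)⁻¹ • (e₁ + e₂) := by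
    rw [smul_smul, smul_smul, smul_add]
    congr 2 <;> field_simp
  rwa [e1, e2] at this

lemma bz_persp_oc {Q : ℝ × ℝ → ℝ≥0∞} (hQ : BzConv 2 Q) (e : ℝ × ℝ) : ∀ a > 0, Set.OrdConnected
    {ρ : ℝ | bzLev 2 a ≤ (if 0 < ρ then ENNReal.ofReal (1 / ρ ^ 2) * Q (ρ⁻¹ • e) else 0)} := by
  intro a ha
  refine Convex.ordConnected (convex_iff_forall_pos.2 ?_)
  intro x hx y hy s t hs ht hst
  simp only [Set.mem_ofPred_eq] at *
  -- rescale
  have hsc : ∀ s x : ℝ, 0 < s →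
      bzLev 2 a ≤ (if 0 < x then ENNReal.ofReal (1 / x ^ 2) * Q (x⁻¹ • e) else 0) →
      bzLev 2 (s * a) ≤ (if 0 < s * x then ENNReal.ofReal (1 / (s * x) ^ 2) * Q ((s * x)⁻¹ • (s • e)) else 0) := by
    intro s x hs h
    have lev0 : ¬ bzLev 2 a ≤ 0 := by
      unfold bzLev; simp; positivity
    by_cases hx : 0 < x
    swap
    · rw [if_neg hx] at h; exact absurd h lev0
    rw [if_pos hx, bz_lev_div hx] at h
    rw [if_pos (by positivity), bz_lev_div (by positivity), smul_smul]
    have e1 : s * a / (s * x) = a / x := by field_simp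
    have e2 : (s * x)⁻¹ * s = x⁻¹ := by field_simp
    rwa [e1, e2]
  have := bz_persp hQ (by positivity) (by positivity) (hsc s x hs hx) (hsc t y ht hy)
  rw [← add_mul, hst, one_mul, ← add_smul, hst, one_smul] at this
  exact this

lemma bz_ray {Q : ℝ × ℝ → ℝ≥0∞} (hQ : BzConv 2 Q) (e₁ e₂ : ℝ × ℝ) :
    (∫⁻ r in Set.Ioi (0:ℝ), Q (r • (e₁ + e₂)))⁻¹ ≤
      (∫⁻ r in Set.Ioi (0:ℝ), Q (r • e₁))⁻¹ + (∫⁻ r in Set.Ioi (0:ℝ), Q (r • e₂))⁻¹ := by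
  rw [← bz_persp_int (f := fun r => Q (r • (e₁ + e₂))), ← bz_persp_int (f := fun r => Q (r • e₁)),
    ← bz_persp_int (f := fun r => Q (r • e₂))]
  exact bz_bbl (bz_meas (bz_persp_oc hQ _)) (bz_meas (bz_persp_oc hQ _)) (bz_meas (bz_persp_oc hQ _))
    (bz_persp_oc hQ _) (fun x y a b ha hb h1 h2 => bz_persp hQ ha hb h1 h2)

lemma bz_line_half {f : ℝ → ℝ≥0∞} (hf : ∀ x, f (-x) = f x) :
    ∫⁻ x, f x = 2 * ∫⁻ x in Set.Ioi (0:ℝ), f x := by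
  have h1 : ∫⁻ x in Set.Iio (0:ℝ), f x = ∫⁻ x in Set.Ioi (0:ℝ), f x := by
    rw [← lintegral_indicator measurableSet_Iio, ← lintegral_indicator measurableSet_Ioi,
      ← lintegral_neg_eq_self]
    refine lintegral_congr fun x => ?_
    by_cases hx : 0 < x
    · rw [Set.indicator_of_mem (by simpa using hx), Set.indicator_of_mem (by simpa using hx), hf]
    · rw [Set.indicator_of_notMem (by simpa using hx), Set.indicator_of_notMem (by simpa using hx)]
  rw [← lintegral_add_compl f (measurableSet_Ioi (a := (0:ℝ))), Set.compl_Ioi,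
    setLIntegral_congr Iio_ae_eq_Iic.symm, h1, two_mul]

lemma bz_line {Q : ℝ × ℝ → ℝ≥0∞} (hQ : BzConv 2 Q) (hev : ∀ z, Q (-z) = Q z) (e₁ e₂ : ℝ × ℝ) :
    (∫⁻ r : ℝ, Q (r • (e₁ + e₂)))⁻¹ ≤ (∫⁻ r : ℝ, Q (r • e₁))⁻¹ + (∫⁻ r : ℝ, Q (r • e₂))⁻¹ := by
  have h : ∀ e : ℝ × ℝ, (∫⁻ r : ℝ, Q (r • e))⁻¹ = 2⁻¹ * (∫⁻ r in Set.Ioi (0:ℝ), Q (r • e))⁻¹ := by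
    intro e
    rw [bz_line_half (f := fun r => Q (r • e)) (fun r => by rw [neg_smul, hev]),
      ENNReal.mul_inv (by simp) (by simp)]
  rw [h, h, h, ← mul_add]
  gcongr
  exact bz_ray hQ e₁ e₂


lemma bz_scale_ball {E : Type*} [NormedAddCommGroup E] [NormedSpace ℝ E] [MeasurableSpace E]
    [BorelSpace E] [FiniteDimensional ℝ E] (μ : Measure E) [μ.IsAddHaarMeasure]
    {q : E → ℝ≥0∞} {t R : ℝ} (ht : 0 < t)
    (hq : ∀ z, ENNReal.ofReal (1 / t ^ Module.finrank ℝ E) * q z ≤ q (t • z)) :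
    ∫⁻ z in Metric.closedBall 0 (R / t), q z ∂μ ≤ ∫⁻ z in Metric.closedBall 0 R, q z ∂μ := by
  set n := Module.finrank ℝ E
  have hpos : 0 < t ^ n := by positivity
  have hemb : MeasurableEmbedding (fun z : E => t • z) :=
    (Homeomorph.smulOfNeZero t ht.ne').measurableEmbedding
  have hmap := Measure.map_addHaar_smul μ ht.ne'
  have h1 : ∫⁻ z in Metric.closedBall 0 R, q z ∂(Measure.map (fun z : E => t • z) μ)
      = ENNReal.ofReal (1 / t ^ n) * ∫⁻ z in Metric.closedBall 0 R, q z ∂μ := by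
    rw [hmap, Measure.restrict_smul, lintegral_smul_measure, abs_of_pos (by positivity), one_div]
    rfl
  have hpre : (fun z : E => t • z) ⁻¹' Metric.closedBall 0 R = Metric.closedBall 0 (R / t) := by
    ext z
    simp only [Set.mem_preimage, Metric.mem_closedBall, dist_zero_right, norm_smul,
      Real.norm_of_nonneg ht.le]
    rw [le_div_iff₀ ht, mul_comm]
  have h2 : ∫⁻ z in Metric.closedBall 0 R, q z ∂(Measure.map (fun z : E => t • z) μ)
      = ∫⁻ z in Metric.closedBall 0 (R / t), q (t • z) ∂μ := by
    rw [hemb.restrict_map, hemb.lintegral_map, hpre]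
  have h3 : ENNReal.ofReal (1 / t ^ n) * ∫⁻ z in Metric.closedBall 0 (R / t), q z ∂μ ≤
      ENNReal.ofReal (1 / t ^ n) * ∫⁻ z in Metric.closedBall 0 R, q z ∂μ := by
    rw [← h1, h2, ← lintegral_const_mul' _ _ ENNReal.ofReal_ne_top]
    exact lintegral_mono fun z => hq z
  exact (ENNReal.mul_le_mul_iff_right (by simp; positivity) ENNReal.ofReal_ne_top).1 h3

lemma bz_scale {E : Type*} [NormedAddCommGroup E] [NormedSpace ℝ E] [MeasurableSpace E]
    [BorelSpace E] [FiniteDimensional ℝ E] [Nontrivial E] (μ : Measure E) [μ.IsAddHaarMeasure]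
    {q : E → ℝ≥0∞} (hfin : ∫⁻ z, q z ∂μ ≠ ⊤)
    (hq : ∀ t : ℝ, 0 < t → t < 1 → ∀ z,
      ENNReal.ofReal (1 / t ^ Module.finrank ℝ E) * q z ≤ q (t • z)) :
    ∫⁻ z, q z ∂μ = 0 := by
  set m := μ.withDensity q with hm
  have hmball : ∀ R, m (Metric.closedBall 0 R) = ∫⁻ z in Metric.closedBall 0 R, q z ∂μ :=
    fun R => withDensity_apply _ Metric.isClosed_closedBall.measurableSet
  have hmu : m Set.univ = ∫⁻ z, q z ∂μ := by
    rw [hm, withDensity_apply _ MeasurableSet.univ, Measure.restrict_univ]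
  have hfm : IsFiniteMeasure m := ⟨by rw [hmu]; exact hfin.lt_top⟩
  have hA : Filter.Tendsto (fun k : ℕ => m (Metric.closedBall (0:E) (1 / ((k:ℝ) + 1)))) Filter.atTop (nhds 0) := by
    have h0 : m (⋂ k : ℕ, Metric.closedBall (0:E) (1 / ((k:ℝ) + 1))) = 0 := by
      have : (⋂ k : ℕ, Metric.closedBall (0:E) (1 / ((k:ℝ) + 1))) = {0} := by
        ext z
        simp only [Set.mem_iInter, Metric.mem_closedBall, dist_zero_right, Set.mem_singleton_iff]
        constructor
        · intro h
          have : ‖z‖ ≤ 0 := ge_of_tendsto' tendsto_one_div_add_atTop_nhds_zero_nat h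
          simpa using this
        · rintro rfl k
          simp; positivity
      rw [this]
      exact withDensity_absolutelyContinuous μ q (measure_singleton 0)
    rw [← h0]
    refine tendsto_measure_iInter_atTop (fun k => Metric.isClosed_closedBall.measurableSet.nullMeasurableSet) ?_ ⟨0, measure_ne_top _ _⟩
    intro i j hij
    refine Metric.closedBall_subset_closedBall ?_
    apply one_div_le_one_div_of_le (by positivity)
    have : (i:ℝ) ≤ j := by exact_mod_cast hij
    linarith
  have hB : Filter.Tendsto (fun k : ℕ => m (Metric.closedBall (0:E) ((k:ℝ) + 1))) Filter.atTop (nhds (m Set.univ)) := by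
    have : (⋃ k : ℕ, Metric.closedBall (0:E) ((k:ℝ) + 1)) = Set.univ := by
      ext z
      simp only [Set.mem_iUnion, Metric.mem_closedBall, dist_zero_right, Set.mem_univ, iff_true]
      obtain ⟨k, hk⟩ := exists_nat_ge ‖z‖
      exact ⟨k, by linarith⟩
    rw [← this]
    refine tendsto_measure_iUnion_atTop ?_
    intro i j hij
    refine Metric.closedBall_subset_closedBall ?_
    have : (i:ℝ) ≤ j := by exact_mod_cast hij
    linarith
  have hle : ∀ᶠ k : ℕ in Filter.atTop, m (Metric.closedBall (0:E) ((k:ℝ) + 1)) ≤ m (Metric.closedBall (0:E) (1 / ((k:ℝ) + 1))) := by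
    filter_upwards [Filter.eventually_ge_atTop 1] with k hk
    have hk' : (1:ℝ) ≤ k := by exact_mod_cast hk
    rw [hmball, hmball]
    have ht : (0:ℝ) < 1 / ((k:ℝ) + 1) ^ 2 := by positivity
    have := bz_scale_ball μ (q := q) (R := 1 / ((k:ℝ) + 1)) ht (hq _ ht (by
      rw [div_lt_one (by positivity)]; nlinarith))
    have e : 1 / ((k:ℝ) + 1) / (1 / ((k:ℝ) + 1) ^ 2) = (k:ℝ) + 1 := by field_simp
    rwa [e] at this
  rw [← hmu]
  exact le_antisymm (le_of_tendsto_of_tendsto hB hA hle) (zero_le)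

lemma bz_marg {Q : ℝ × ℝ → ℝ≥0∞} (hQ : BzConv 2 Q) (hev : ∀ z, Q (-z) = Q z)
    {g : ℝ → ℝ≥0∞} (hg : g =ᵐ[volume] fun σ => ∫⁻ y, Q (σ, y)) (hg1 : ∫⁻ x, g x = 1) :
    essSup g volume = ∫⁻ y, Q (0, y) ∧ ∫⁻ y, Q (0, y) ≠ 0 ∧ ∫⁻ y, Q (0, y) ≠ ⊤ := by
  set G : ℝ → ℝ≥0∞ := fun σ => ∫⁻ y, Q (σ, y) with hG
  have hconv : ∀ {s t : ℝ}, 0 < s → 0 < t → s + t = 1 → ∀ σ τ : ℝ,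
      (G (s * σ + t * τ))⁻¹ ≤ ENNReal.ofReal s * (G σ)⁻¹ + ENNReal.ofReal t * (G τ)⁻¹ :=
    fun hs ht hst σ τ => bz_gconv hQ hs ht hst σ τ
  have hG1 : ∫⁻ x, G x = 1 := by rw [← hg1]; exact (lintegral_congr_ae hg).symm
  have hGev : ∀ σ, G (-σ) = G σ := by
    intro σ
    simp only [hG]
    rw [← lintegral_neg_eq_self]
    refine lintegral_congr fun y => ?_
    rw [← hev]; simp
  have hmax : ∀ σ, G σ ≤ G 0 := by
    intro σ
    have := hconv (s := 1/2) (t := 1/2) (by norm_num) (by norm_num) (by norm_num) σ (-σ)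
    rw [hGev, ← add_mul, ← ENNReal.ofReal_add (by norm_num) (by norm_num)] at this
    norm_num at this
    exact this
  have hne0 : G 0 ≠ 0 := by
    intro h0
    have : ∀ σ, G σ = 0 := fun σ => le_antisymm (h0 ▸ hmax σ) zero_le
    simp [this] at hG1
  have hnet : G 0 ≠ ⊤ := by
    intro h0
    have : ∫⁻ x, G x = 0 := by
      refine bz_scale volume (by simp [hG1]) ?_
      intro t ht ht1 z
      have := hconv (s := 1 - t) (t := t) (by linarith) ht (by ring) 0 z
      rw [h0, ENNReal.inv_top, mul_zero, mul_zero, zero_add, zero_add] at this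
      have h2 := ENNReal.inv_le_inv.2 this
      rw [inv_inv, ENNReal.mul_inv (Or.inl (by simpa using ht)) (Or.inl ENNReal.ofReal_ne_top), inv_inv,
        ← ENNReal.ofReal_inv_of_pos ht] at h2
      simpa using h2
    simp [hG1] at this
  refine ⟨?_, hne0, hnet⟩
  rw [essSup_congr_ae hg]
  refine le_antisymm (essSup_le_of_ae_le _ (Filter.Eventually.of_forall hmax)) ?_
  set N := essSup G volume with hN
  have hae : ∀ᵐ x, G x ≤ N := ENNReal.ae_le_essSup G
  obtain ⟨σ₀, hσ₀, hGσ⟩ : ∃ σ₀ : ℝ, σ₀ ≠ 0 ∧ G σ₀ ≠ 0 := by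
    by_contra hcon
    push Not at hcon
    have : ∫⁻ x, G x = 0 := by
      rw [← lintegral_zero (μ := (volume : Measure ℝ))]
      refine lintegral_congr_ae ?_
      filter_upwards [Measure.ae_ne volume (0:ℝ)] with x hx
      exact hcon x hx
    simp [hG1] at this
  have hae2 : ∀ᵐ t : ℝ, G (t * σ₀) ≤ N := by
    have hqm : Measure.QuasiMeasurePreserving (fun t : ℝ => t * σ₀) volume volume := by
      refine ⟨by fun_prop, ?_⟩
      rw [Real.map_volume_mul_right hσ₀]
      exact Measure.smul_absolutelyContinuous
    exact hqm.ae hae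
  have hbd : ∀ ε : ℝ, 0 < ε → ε < 1 → N⁻¹ ≤ (G 0)⁻¹ + ENNReal.ofReal ε * (G σ₀)⁻¹ := by
    intro ε hε hε1
    obtain ⟨t, ht, htN⟩ : ∃ t ∈ Set.Ioo (0:ℝ) ε, G (t * σ₀) ≤ N := by
      by_contra hcon
      push Not at hcon
      have : volume (Set.Ioo (0:ℝ) ε) ≤ 0 := by
        rw [← ae_iff.1 hae2]
        exact measure_mono fun t ht => not_le.2 (hcon t ht)
      simp at this
      linarith
    have := hconv (s := 1 - t) (t := t) (by linarith [ht.2]) ht.1 (by ring) 0 σ₀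
    rw [mul_zero, zero_add] at this
    refine (ENNReal.inv_le_inv.2 htN).trans (this.trans ?_)
    gcongr
    · calc ENNReal.ofReal (1 - t) * (G 0)⁻¹ ≤ 1 * (G 0)⁻¹ := by
            gcongr
            exact ENNReal.ofReal_le_one.2 (by linarith [ht.1])
        _ = _ := one_mul _
    · exact ht.2.le
  have hlim : Filter.Tendsto (fun ε : ℝ => (G 0)⁻¹ + ENNReal.ofReal ε * (G σ₀)⁻¹) (nhdsWithin 0 (Set.Ioi 0))
      (nhds ((G 0)⁻¹ + ENNReal.ofReal 0 * (G σ₀)⁻¹)) := by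
    refine tendsto_const_nhds.add (ENNReal.Tendsto.mul_const ?_ (Or.inr (by simpa using hGσ)))
    exact (ENNReal.continuous_ofReal.tendsto 0).mono_left nhdsWithin_le_nhds
  have := ge_of_tendsto hlim (by
    filter_upwards [Ioo_mem_nhdsGT (zero_lt_one (α := ℝ))] with ε hε
    exact hbd ε hε.1 hε.2)
  simp only [ENNReal.ofReal_zero, zero_mul, add_zero] at this
  exact ENNReal.inv_le_inv.1 this


lemma bz_exists_lev' {n : ℕ} (hn : n ≠ 0) {A : ℝ≥0∞} (hA : A ≠ 0) (hA' : A ≠ ⊤) :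
    ∃ a : ℝ, 0 < a ∧ bzLev n a = A := by
  have h0 : 0 < A.toReal := ENNReal.toReal_pos hA hA'
  refine ⟨(A.toReal⁻¹) ^ (1 / (n:ℝ)), by positivity, ?_⟩
  unfold bzLev
  rw [one_div (n:ℝ), Real.rpow_inv_natCast_pow (by positivity) hn]
  simp [ENNReal.ofReal_toReal hA']

lemma bz_top_of_lev {n : ℕ} (hn : n ≠ 0) {y : ℝ≥0∞} (h : ∀ a : ℝ, 0 < a → bzLev n a ≤ y) : y = ⊤ := by
  refine ENNReal.eq_top_of_forall_nnreal_le fun r => ?_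
  rcases eq_or_ne r 0 with rfl | hr
  · simp
  obtain ⟨a, ha, har⟩ := bz_exists_lev' hn (A := (r : ℝ≥0∞)) (by simpa using hr) ENNReal.coe_ne_top
  rw [← har]; exact h a ha

/-- scaling when infinite at the origin -/
lemma bz_conv_scale {E : Type*} [AddCommGroup E] [Module ℝ E] {n : ℕ} (hn : n ≠ 0) {Q : E → ℝ≥0∞}
    (hQ : BzConv n Q) (h0 : Q 0 = ⊤) {t : ℝ} (ht : 0 < t) (ht1 : t < 1) (z : E) :
    ENNReal.ofReal (1 / t ^ n) * Q z ≤ Q (t • z) := by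
  have hT : ENNReal.ofReal (1 / t ^ n) ≠ 0 := by simp; positivity
  rw [mul_comm, ← ENNReal.le_div_iff_mul_le (Or.inl hT) (Or.inl ENNReal.ofReal_ne_top)]
  refine le_of_forall_lt_imp_le_of_dense fun c hc => ?_
  rw [ENNReal.le_div_iff_mul_le (Or.inl hT) (Or.inl ENNReal.ofReal_ne_top)]
  rcases eq_or_ne c 0 with rfl | hc0
  · simp
  obtain ⟨b, hb, rfl⟩ := bz_exists_lev' hn hc0 (ne_top_of_lt hc)
  have h1 : ∀ a : ℝ, 0 < a → bzLev n ((1 - t) * a + t * b) ≤ Q (t • z) := by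
    intro a ha
    have := hQ 0 z (1 - t) t a b (by linarith) ht (by ring) ha hb (by simp [h0]) hc.le
    simpa using this
  have h2 : bzLev n b * ENNReal.ofReal (1 / t ^ n) = bzLev n ((1 - t) * 0 + t * b) := by
    unfold bzLev
    rw [← ENNReal.ofReal_mul (by positivity)]
    congr 1
    rw [mul_zero, zero_add, mul_pow]
    field_simp
  rw [h2]
  have hc : ContinuousAt (fun a : ℝ => bzLev n ((1 - t) * a + t * b)) 0 := by
    unfold bzLev
    refine ENNReal.continuous_ofReal.continuousAt.comp ?_
    refine ContinuousAt.div (by fun_prop) (by fun_prop) ?_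
    have : 0 < t * b := by positivity
    simp only [mul_zero, zero_add]
    positivity
  refine le_of_tendsto (hc.tendsto.mono_left (nhdsWithin_le_nhds (s := Set.Ioi 0))) ?_
  filter_upwards [self_mem_nhdsWithin] with a ha
  exact h1 a ha

section bzDens

variable {E : Type*} [NormedAddCommGroup E] [NormedSpace ℝ E] [MeasurableSpace E]
    [BorelSpace E] [FiniteDimensional ℝ E]

/-- lower density -/
def bzD (ν μ : Measure E) (p : E) : ℝ≥0∞ :=
  Filter.liminf (fun r : ℝ => ν (Metric.closedBall p r) / μ (Metric.closedBall p r)) (nhdsWithin 0 (Set.Ioi 0))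

/-- convexity inequality on balls -/
def BzBall (ν : Measure E) : Prop :=
  ∀ p q : E, ∀ s t r r' : ℝ, 0 < s → 0 < t → s + t = 1 → 0 < r → 0 < r' →
    min (ν (Metric.closedBall p r)) (ν (Metric.closedBall q r')) ≤
      ν (Metric.closedBall (s • p + t • q) (s * r + t * r'))

lemma bz_vol_ball (μ : Measure E) [μ.IsAddHaarMeasure] (p : E) {r : ℝ} (hr : 0 < r) :
    μ (Metric.closedBall p r) = ENNReal.ofReal (r ^ Module.finrank ℝ E) * μ (Metric.closedBall 0 1) := by
  rw [Measure.addHaar_closedBall' μ p hr.le]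

lemma bz_tendsto_mul {a : ℝ} (ha : 0 < a) :
    Filter.Tendsto (fun r : ℝ => a * r) (nhdsWithin 0 (Set.Ioi 0)) (nhdsWithin 0 (Set.Ioi 0)) := by
  refine tendsto_nhdsWithin_iff.2 ⟨?_, ?_⟩
  · have : Filter.Tendsto (fun r : ℝ => a * r) (nhds 0) (nhds (a * 0)) := by
      exact (continuous_const_mul a).tendsto 0
    rw [mul_zero] at this
    exact this.mono_left nhdsWithin_le_nhds
  · filter_upwards [self_mem_nhdsWithin] with r hr
    exact mul_pos ha hr

lemma bz_conv_D {ν μ : Measure E} [μ.IsAddHaarMeasure] (hν : BzBall ν) :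
    BzConv (Module.finrank ℝ E) (bzD ν μ) := by
  intro p q s t a b hs ht hst ha hb hp hq
  set n := Module.finrank ℝ E with hn
  set V := μ (Metric.closedBall (0:E) 1) with hV
  have hV0 : V ≠ 0 := (Metric.measure_closedBall_pos μ 0 one_pos).ne'
  have hVt : V ≠ ⊤ := (isCompact_closedBall (0:E) 1).measure_lt_top.ne
  have hc : 0 < s * a + t * b := by positivity
  have lev0 : ∀ a : ℝ, 0 < a → bzLev n a ≠ 0 := by
    intro a ha; unfold bzLev; simp; positivity
  have key : ∀ (p : E) (a : ℝ), 0 < a → bzLev n a ≤ bzD ν μ p → ∀ θ : ℝ, 0 < θ → θ < 1 →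
      ∀ᶠ r in nhdsWithin (0:ℝ) (Set.Ioi 0),
        ENNReal.ofReal θ * (ENNReal.ofReal (r ^ n) * V) ≤ ν (Metric.closedBall p (a * r)) := by
    intro p a ha hp θ hθ hθ1
    have hlt : ENNReal.ofReal θ * bzLev n a < bzD ν μ p := by
      refine lt_of_lt_of_le ?_ hp
      calc ENNReal.ofReal θ * bzLev n a < 1 * bzLev n a := by
            refine ENNReal.mul_lt_mul_left (lev0 a ha) ENNReal.ofReal_ne_top ?_
            exact ENNReal.ofReal_lt_one.2 hθ1
        _ = _ := one_mul _
    have h1 := Filter.eventually_lt_of_lt_liminf hlt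
    have h2 := (bz_tendsto_mul ha).eventually h1
    filter_upwards [h2, self_mem_nhdsWithin] with r hr hr0
    have hr0' : (0:ℝ) < r := hr0
    have hvol := bz_vol_ball μ p (mul_pos ha hr0')
    rw [hvol] at hr
    have h3 := (ENNReal.le_div_iff_mul_le (Or.inl (mul_ne_zero (by simp; positivity) hV0))
      (Or.inl (ENNReal.mul_ne_top ENNReal.ofReal_ne_top hVt))).1 hr.le
    refine le_trans (le_of_eq ?_) h3
    unfold bzLev
    rw [← mul_assoc, ← mul_assoc, ← ENNReal.ofReal_mul (by positivity), ← ENNReal.ofReal_mul (by positivity),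
      ← ENNReal.ofReal_mul (by positivity)]
    congr 2
    rw [mul_pow, ← hn]
    field_simp
  have main : ∀ θ : ℝ, 0 < θ → θ < 1 → ENNReal.ofReal θ * bzLev n (s * a + t * b) ≤ bzD ν μ (s • p + t • q) := by
    intro θ hθ hθ1
    refine Filter.le_liminf_of_le (by isBoundedDefault) ?_
    have h3 : ∀ᶠ r in nhdsWithin (0:ℝ) (Set.Ioi 0),
        ENNReal.ofReal θ * (ENNReal.ofReal (r ^ n) * V) ≤
          ν (Metric.closedBall (s • p + t • q) ((s * a + t * b) * r)) := by
      filter_upwards [key p a ha hp θ hθ hθ1, key q b hb hq θ hθ hθ1, self_mem_nhdsWithin] with r h1 h2 hr0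
      have hr0' : (0:ℝ) < r := hr0
      have := (le_min h1 h2).trans (hν p q s t _ _ hs ht hst (mul_pos ha hr0') (mul_pos hb hr0'))
      have e : (s * a + t * b) * r = s * (a * r) + t * (b * r) := by ring
      rw [e]; exact this
    have h4 := (bz_tendsto_mul (inv_pos.2 hc)).eventually h3
    filter_upwards [h4, self_mem_nhdsWithin] with r hr hr0
    have hr0' : (0:ℝ) < r := hr0
    rw [mul_inv_cancel_left₀ hc.ne'] at hr
    rw [bz_vol_ball μ _ hr0', ENNReal.le_div_iff_mul_le (Or.inl (mul_ne_zero (by simp; positivity) hV0))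
      (Or.inl (ENNReal.mul_ne_top ENNReal.ofReal_ne_top hVt))]
    refine le_trans (le_of_eq ?_) hr
    unfold bzLev
    rw [← mul_assoc, ← mul_assoc, ← ENNReal.ofReal_mul (by positivity), ← ENNReal.ofReal_mul (by positivity),
      ← ENNReal.ofReal_mul (by positivity)]
    congr 2
    rw [mul_pow, inv_pow, ← hn]
    field_simp
  have hlim : Filter.Tendsto (fun θ : ℝ => ENNReal.ofReal θ * bzLev n (s * a + t * b)) (nhdsWithin 1 (Set.Iio 1))
      (nhds (ENNReal.ofReal 1 * bzLev n (s * a + t * b))) := by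
    refine ENNReal.Tendsto.mul_const ?_ (Or.inr ENNReal.ofReal_ne_top)
    exact (ENNReal.continuous_ofReal.tendsto 1).mono_left nhdsWithin_le_nhds
  rw [ENNReal.ofReal_one, one_mul] at hlim
  refine le_of_tendsto hlim ?_
  filter_upwards [Ioo_mem_nhdsLT (zero_lt_one (α := ℝ))] with θ hθ
  exact main θ hθ.1 hθ.2

lemma bz_D_even {ν μ : Measure E} [μ.IsAddHaarMeasure]
    (hev : ∀ p r, ν (Metric.closedBall (-p) r) = ν (Metric.closedBall p r)) (p : E) :
    bzD ν μ (-p) = bzD ν μ p := by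
  unfold bzD
  simp_rw [hev, Measure.addHaar_closedBall_center μ]

lemma bz_D_ae {ν μ : Measure E} [μ.IsAddHaarMeasure] [IsFiniteMeasure ν] :
    bzD ν μ =ᵐ[μ] ν.rnDeriv μ := by
  filter_upwards [Besicovitch.ae_tendsto_rnDeriv ν μ] with x hx
  exact hx.liminf_eq

lemma bz_D_top {ν μ : Measure E} [μ.IsAddHaarMeasure] [IsFiniteMeasure ν] {N : Set E}
    (hN : MeasurableSet N) (hN0 : μ N = 0) : ∀ᵐ x ∂ν, x ∈ N → bzD ν μ x = ⊤ := by
  have h1 : ∀ᵐ x ∂ν, x ∈ N → μ.rnDeriv ν x = 0 := by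
    have : ∫⁻ x in N, μ.rnDeriv ν x ∂ν = 0 :=
      le_antisymm ((Measure.setLIntegral_rnDeriv_le N).trans hN0.le) zero_le
    rw [lintegral_eq_zero_iff (Measure.measurable_rnDeriv _ _)] at this
    exact (ae_restrict_iff' hN).1 this
  filter_upwards [h1, Besicovitch.ae_tendsto_rnDeriv μ ν] with x hx hx2 hxN
  rw [hx hxN] at hx2
  have h3 := tendsto_inv_iff.2 hx2
  rw [ENNReal.inv_zero] at h3
  have h4 : Filter.Tendsto (fun r : ℝ => ν (Metric.closedBall x r) / μ (Metric.closedBall x r))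
      (nhdsWithin 0 (Set.Ioi 0)) (nhds ⊤) := by
    refine h3.congr' ?_
    filter_upwards [self_mem_nhdsWithin] with r hr
    exact ENNReal.inv_div (Or.inl (measure_ne_top _ _))
      (Or.inr (Metric.measure_closedBall_pos μ x hr).ne')
  exact h4.liminf_eq

lemma bz_ac [Nontrivial E] {ν μ : Measure E} [μ.IsAddHaarMeasure] [IsFiniteMeasure ν] (hν : BzBall ν)
    (hev : ∀ p r, ν (Metric.closedBall (-p) r) = ν (Metric.closedBall p r))
    (hspan : ∀ L : AffineSubspace ℝ E, ν (L : Set E)ᶜ = 0 → L = ⊤) : ν ≪ μ := by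
  have hn : Module.finrank ℝ E ≠ 0 := Module.finrank_pos.ne'
  have hconv := bz_conv_D (μ := μ) hν
  set S : Set E := {x | bzD ν μ x = ⊤} with hS
  have hSconv : Convex ℝ S := by
    rw [convex_iff_forall_pos]
    intro x hx y hy s t hs ht hst
    have hx' : bzD ν μ x = ⊤ := hx
    have hy' : bzD ν μ y = ⊤ := hy
    refine bz_top_of_lev hn fun a ha => ?_
    have := hconv x y s t a a hs ht hst ha ha (by simp [hx']) (by simp [hy'])
    rwa [← add_mul, hst, one_mul] at this
  by_contra hcon
  obtain ⟨x, hx⟩ : S.Nonempty := by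
    by_contra hSe
    apply hcon
    refine Measure.AbsolutelyContinuous.mk fun N hN hN0 => ?_
    have h := bz_D_top (ν := ν) hN hN0
    rw [measure_eq_zero_iff_ae_notMem]
    filter_upwards [h] with x hx hxN
    exact hSe ⟨x, hx hxN⟩
  have hx2 : -x ∈ S := by
    show bzD ν μ (-x) = ⊤
    rw [bz_D_even hev]; exact hx
  have h0 : bzD ν μ 0 = ⊤ := by
    have := hSconv hx hx2 (a := 1/2) (b := 1/2) (by norm_num) (by norm_num) (by norm_num)
    have e : (1/2 : ℝ) • x + (1/2 : ℝ) • (-x) = 0 := by module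
    rw [e] at this
    exact this
  have hDzero : ∫⁻ z, bzD ν μ z ∂μ = 0 := by
    refine bz_scale μ ?_ (fun t ht ht1 z => bz_conv_scale hn hconv h0 ht ht1 z)
    rw [lintegral_congr_ae bz_D_ae]
    exact (Measure.lintegral_rnDeriv_lt_top ν μ).ne
  have hrn : ν.rnDeriv μ =ᵐ[μ] 0 := by
    rw [lintegral_congr_ae bz_D_ae, lintegral_eq_zero_iff (Measure.measurable_rnDeriv _ _)] at hDzero
    exact hDzero
  obtain ⟨N, hN, hN1, hN2⟩ := (Measure.rnDeriv_eq_zero ν μ).1 hrn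
  have hSc : ν Sᶜ = 0 := by
    have h := bz_D_top (ν := ν) hN.compl hN2
    rw [measure_eq_zero_iff_ae_notMem]
    filter_upwards [h, measure_eq_zero_iff_ae_notMem.1 hN1] with x hx hxN hxS
    exact hxS (hx hxN)
  have hL := hspan (affineSpan ℝ S) (measure_mono_null (Set.compl_subset_compl.2 (subset_affineSpan ℝ S)) hSc)
  have hne := hSconv.interior_nonempty_iff_affineSpan_eq_top.2 hL
  have hpos : 0 < μ (interior S) := isOpen_interior.measure_pos μ hne
  have hz : μ (interior S) = 0 := by
    rw [measure_eq_zero_iff_ae_notMem]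
    filter_upwards [hrn, bz_D_ae (ν := ν) (μ := μ)] with x h1 h2 hxS
    have hxS' : x ∈ S := interior_subset hxS
    have : bzD ν μ x = ⊤ := hxS'
    rw [h2, h1] at this
    simp at this
  exact hpos.ne' hz

end bzDens


lemma bz_min_le_genMean (κ : EReal) {t a b : ℝ} (ht : t ∈ Set.Icc (0:ℝ) 1) (ha : 0 ≤ a) (hb : 0 ≤ b) :
    min a b ≤ genMean κ t a b := by
  obtain ⟨ht0, ht1⟩ := ht
  have ht1' : 0 ≤ 1 - t := by linarith
  have hm : 0 ≤ min a b := le_min ha hb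
  unfold genMean
  split_ifs with h1 h2 h3 h4
  · exact le_rfl
  · exact min_le_max
  · rcases hm.eq_or_lt with h | h
    · rw [← h]; positivity
    · calc min a b = (min a b) ^ (1 - t) * (min a b) ^ t := by
            rw [← Real.rpow_add h]; simp
        _ ≤ _ := by
            gcongr
            · exact min_le_left _ _
            · exact min_le_right _ _
  · rcases h4.2 with h | h
    · rw [h]; exact min_le_left _ _
    · rw [h]; exact min_le_right _ _
  · set k := κ.toReal with hk
    have hk0 : k ≠ 0 := by
      intro h
      rw [hk, EReal.toReal_eq_zero_iff] at h
      tauto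
    have e : ((min a b) ^ k) ^ (1 / k) = min a b := by
      rw [← Real.rpow_mul hm, mul_one_div_cancel hk0, Real.rpow_one]
    rcases lt_or_gt_of_ne hk0 with hneg | hpos
    · have ha' : 0 < a := lt_of_le_of_ne ha fun h => h4 ⟨hneg, Or.inl h.symm⟩
      have hb' : 0 < b := lt_of_le_of_ne hb fun h => h4 ⟨hneg, Or.inr h.symm⟩
      have hm' : 0 < min a b := lt_min ha' hb'
      have i1 : a ^ k ≤ (min a b) ^ k := Real.rpow_le_rpow_of_nonpos hm' (min_le_left _ _) hneg.le
      have i2 : b ^ k ≤ (min a b) ^ k := Real.rpow_le_rpow_of_nonpos hm' (min_le_right _ _) hneg.le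
      have i3 : (1 - t) * a ^ k + t * b ^ k ≤ (min a b) ^ k := by nlinarith
      have p1 : 0 < a ^ k := Real.rpow_pos_of_pos ha' k
      have p2 : 0 < b ^ k := Real.rpow_pos_of_pos hb' k
      have i4 : 0 < (1 - t) * a ^ k + t * b ^ k := by
        rcases ht0.eq_or_lt with h | h
        · rw [← h]; simpa using p1
        · have := mul_pos h p2
          have := mul_nonneg ht1' p1.le
          linarith
      calc min a b = ((min a b) ^ k) ^ (1 / k) := e.symm
        _ ≤ _ := Real.rpow_le_rpow_of_nonpos i4 i3 (one_div_nonpos.2 hneg.le)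
    · have i1 : (min a b) ^ k ≤ a ^ k := Real.rpow_le_rpow hm (min_le_left _ _) hpos.le
      have i2 : (min a b) ^ k ≤ b ^ k := Real.rpow_le_rpow hm (min_le_right _ _) hpos.le
      have i3 : (min a b) ^ k ≤ (1 - t) * a ^ k + t * b ^ k := by nlinarith
      calc min a b = ((min a b) ^ k) ^ (1 / k) := e.symm
        _ ≤ _ := Real.rpow_le_rpow (Real.rpow_nonneg hm _) i3 (one_div_nonneg.2 hpos.le)

lemma bz_ball_of_concave {E F : Type*} [AddCommGroup E] [Module ℝ E] [TopologicalSpace E]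
    [MeasurableSpace E] [NormedAddCommGroup F] [NormedSpace ℝ F] [MeasurableSpace F] [BorelSpace F]
    [FiniteDimensional ℝ F]
    {κ : EReal} {μ : Measure E} [IsFiniteMeasure μ] (hμ : IsKappaConcave κ μ)
    (T : E →ₗ[ℝ] F) (hT : Measurable T) : BzBall (μ.map T) := by
  intro p q s t r r' hs ht hst hr hr'
  have hb : ∀ (p : F) (r : ℝ), MeasurableSet (Metric.closedBall p r) :=
    fun p r => measurableSet_closedBall
  rw [Measure.map_apply hT (hb _ _), Measure.map_apply hT (hb _ _), Measure.map_apply hT (hb _ _)]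
  have h := hμ.2 _ _ (hT (hb p r)) (hT (hb q r')) t ⟨ht.le, by linarith⟩
  have h2 := (bz_min_le_genMean κ (t := t) ⟨ht.le, by linarith⟩
    (a := (μ (T ⁻¹' Metric.closedBall p r)).toReal) (b := (μ (T ⁻¹' Metric.closedBall q r')).toReal)
    ENNReal.toReal_nonneg ENNReal.toReal_nonneg).trans h
  have h3 : min (μ (T ⁻¹' Metric.closedBall p r)) (μ (T ⁻¹' Metric.closedBall q r')) ≤
      μ ((1 - t) • (T ⁻¹' Metric.closedBall p r) + t • (T ⁻¹' Metric.closedBall q r')) := by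
    rw [← ENNReal.toReal_min (measure_ne_top _ _) (measure_ne_top _ _)] at h2
    exact (ENNReal.toReal_le_toReal (by simp) (measure_ne_top _ _)).1 h2
  refine h3.trans (measure_mono ?_)
  have hs' : 1 - t = s := by linarith
  rw [hs']
  rintro _ ⟨_, ⟨x, hx, rfl⟩, _, ⟨y, hy, rfl⟩, rfl⟩
  simp only [Set.mem_preimage, Metric.mem_closedBall, dist_eq_norm, map_add, map_smul] at hx hy ⊢
  have e : s • T x + t • T y - (s • p + t • q) = s • (T x - p) + t • (T y - q) := by module
  rw [e]
  refine (norm_add_le _ _).trans ?_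
  rw [norm_smul, norm_smul, Real.norm_of_nonneg hs.le, Real.norm_of_nonneg ht.le]
  gcongr

lemma bz_even_map {E F : Type*} [AddCommGroup E] [Module ℝ E]
    [MeasurableSpace E] [MeasurableNeg E] [NormedAddCommGroup F] [NormedSpace ℝ F] [MeasurableSpace F] [BorelSpace F]
    {μ : Measure E} (hμ : μ.map (fun x => -x) = μ)
    (T : E →ₗ[ℝ] F) (hT : Measurable T) (p : F) (r : ℝ) :
    μ.map T (Metric.closedBall (-p) r) = μ.map T (Metric.closedBall p r) := by
  rw [Measure.map_apply hT measurableSet_closedBall, Measure.map_apply hT measurableSet_closedBall]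
  conv_rhs => rw [← hμ]
  rw [Measure.map_apply measurable_neg (hT measurableSet_closedBall)]
  congr 1
  ext x
  simp only [Set.mem_preimage, Metric.mem_closedBall, dist_eq_norm, map_neg]
  rw [← norm_neg]
  congr! 2
  abel

lemma bz_span {E F : Type*} [NormedAddCommGroup E] [NormedSpace ℝ E]
    [MeasurableSpace E] [NormedAddCommGroup F] [NormedSpace ℝ F] [MeasurableSpace F] [BorelSpace F]
    [FiniteDimensional ℝ F]
    {μ : Measure E} (hμ : (interior {x : E | ∀ U ∈ nhds x, 0 < μ U}).Nonempty)
    (T : E →ₗ[ℝ] F) (hT : Measurable T) (hTc : Continuous T) (hTs : Function.Surjective T)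
    (L : AffineSubspace ℝ F) (hL : μ.map T (L : Set F)ᶜ = 0) : L = ⊤ := by
  have hLc : IsClosed (L : Set F) := AffineSubspace.closed_of_finiteDimensional L
  rw [Measure.map_apply hT hLc.measurableSet.compl] at hL
  have hsub : interior {x : E | ∀ U ∈ nhds x, 0 < μ U} ⊆ (L.comap T.toAffineMap : Set E) := by
    intro x hx
    by_contra hxL
    have hx' := interior_subset hx
    have : T ⁻¹' (L : Set F)ᶜ ∈ nhds x := (hLc.isOpen_compl.preimage hTc).mem_nhds hxL
    exact (hx' _ this).ne' hL
  have h1 : L.comap T.toAffineMap = ⊤ := by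
    rw [← top_le_iff, ← IsOpen.affineSpan_eq_top isOpen_interior hμ]
    exact affineSpan_le.2 hsub
  rw [← top_le_iff]
  intro y _
  obtain ⟨x, rfl⟩ := hTs y
  have : x ∈ L.comap T.toAffineMap := by rw [h1]; trivial
  exact this

lemma bz_density {ν : Measure (ℝ × ℝ)} [IsFiniteMeasure ν] (hac : ν ≪ volume)
    (φ : ℝ × ℝ → ℝ × ℝ) (hφ : MeasurePreserving φ volume volume)
    {l : ℝ × ℝ → ℝ} (hl : Measurable l) (hlφ : ∀ z, l (φ z) = z.1)
    {g : ℝ → ℝ≥0∞} (hgm : Measurable g) (hg : ν.map l = volume.withDensity g)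
    {D : ℝ × ℝ → ℝ≥0∞} (hD : D =ᵐ[volume] ν.rnDeriv volume) :
    g =ᵐ[volume] fun σ => ∫⁻ r, D (φ (σ, r)) := by
  set R := ν.rnDeriv volume with hR
  have hRm : Measurable R := Measure.measurable_rnDeriv _ _
  have hRφ : Measurable (fun z => R (φ z)) := hRm.comp hφ.measurable
  have hGm : Measurable (fun σ => ∫⁻ r, R (φ (σ, r))) := hRφ.lintegral_prod_right'
  have h1 : g =ᵐ[volume] fun σ => ∫⁻ r, R (φ (σ, r)) := by
    rw [← withDensity_eq_iff_of_sigmaFinite hgm.aemeasurable hGm.aemeasurable, ← hg]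
    ext S hS
    rw [Measure.map_apply hl hS, withDensity_apply _ hS, ← Measure.setLIntegral_rnDeriv hac,
      ← lintegral_indicator (hl hS), ← lintegral_indicator hS,
      ← hφ.lintegral_comp (hRm.indicator (hl hS)), Measure.volume_eq_prod,
      lintegral_prod (fun z => (l ⁻¹' S).indicator R (φ z))
        ((hRm.indicator (hl hS)).comp hφ.measurable).aemeasurable]
    refine lintegral_congr fun σ => ?_
    by_cases h : σ ∈ S
    · simp [Set.indicator, hlφ, h, hR]
    · simp [Set.indicator, hlφ, h]
  have h2 : (fun z => D (φ z)) =ᵐ[volume] fun z => R (φ z) := hφ.quasiMeasurePreserving.ae_eq_comp hD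
  rw [Measure.volume_eq_prod] at h2
  have h3 := Measure.ae_ae_of_ae_prod h2
  filter_upwards [h1, h3] with σ a b
  rw [a]
  exact (lintegral_congr_ae b).symm

lemma bz_conv_comp {E F : Type*} [AddCommGroup E] [Module ℝ E] [AddCommGroup F] [Module ℝ F] {n : ℕ}
    {Q : F → ℝ≥0∞} (hQ : BzConv n Q) (φ : E →ₗ[ℝ] F) : BzConv n (fun z => Q (φ z)) := by
  intro p q s t a b hs ht hst ha hb hp hq
  have := hQ _ _ s t a b hs ht hst ha hb hp hq
  simpa using this

lemma bz_norm_top {g : ℝ → ℝ} (hg : ∀ x, 0 ≤ g x) :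
    eLpNorm g ⊤ volume = essSup (fun x => ENNReal.ofReal (g x)) volume := by
  rw [eLpNorm_exponent_top, eLpNormEssSup]
  congr 1
  ext x
  exact Real.enorm_of_nonneg (hg x)

lemma bz_val {g : ℝ → ℝ} (h0 : eLpNorm g ⊤ volume ≠ 0) (ht : eLpNorm g ⊤ volume ≠ ⊤) :
    sqrtInfRenyiPower1 g = ((eLpNorm g ⊤ volume)⁻¹).toReal := by
  unfold sqrtInfRenyiPower1
  rw [Real.exp_neg, Real.exp_log (ENNReal.toReal_pos h0 ht), ENNReal.toReal_inv]


lemma bz_side {ν : Measure (ℝ × ℝ)} [IsProbabilityMeasure ν] (hac : ν ≪ volume)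
    (φ : ℝ × ℝ →ₗ[ℝ] ℝ × ℝ) (hφ : MeasurePreserving φ volume volume)
    {l : ℝ × ℝ → ℝ} (hl : Measurable l) (hlφ : ∀ z, l (φ z) = z.1)
    {g : ℝ → ℝ} (hgm : Measurable g) (hg0 : ∀ x, 0 ≤ g x)
    (hg : ν.map l = volume.withDensity (fun x => ENNReal.ofReal (g x)))
    {D : ℝ × ℝ → ℝ≥0∞} (hD : D =ᵐ[volume] ν.rnDeriv volume) (hc : BzConv 2 D)
    (hev : ∀ z, D (-z) = D z) :
    sqrtInfRenyiPower1 g = ((∫⁻ r : ℝ, D (r • φ (0, 1)))⁻¹).toReal ∧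
      (∫⁻ r : ℝ, D (r • φ (0, 1)))⁻¹ ≠ ⊤ := by
  have h1 := bz_density hac φ hφ hl hlφ hgm.ennreal_ofReal hg hD
  have hone : ∫⁻ x, ENNReal.ofReal (g x) = 1 := by
    have : (ν.map l) Set.univ = 1 := by
      rw [Measure.map_apply hl MeasurableSet.univ]; simp
    rw [hg, withDensity_apply _ MeasurableSet.univ, Measure.restrict_univ] at this
    exact this
  obtain ⟨a, b, c⟩ := bz_marg (bz_conv_comp hc φ) (fun z => by simp [hev]) h1 hone
  have e : ∀ r : ℝ, φ (0, r) = r • φ (0, 1) := by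
    intro r
    rw [← map_smul]
    simp
  have e' : ∫⁻ y, D (φ (0, y)) = ∫⁻ r : ℝ, D (r • φ (0, 1)) :=
    lintegral_congr fun r => by rw [e r]
  rw [e'] at a b c
  rw [← bz_norm_top hg0] at a
  rw [← a] at b c ⊢
  exact ⟨bz_val b c, ENNReal.inv_ne_top.2 b⟩

lemma bz_surj {ν : Measure (ℝ × ℝ)} [IsProbabilityMeasure ν] (hν : BzBall ν)
    (hev : ∀ p r, ν (Metric.closedBall (-p) r) = ν (Metric.closedBall p r))
    (hac : ν ≪ volume) {gu gv gs : ℝ → ℝ}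
    (mu : Measurable gu) (mv : Measurable gv) (ms : Measurable gs)
    (pu : ∀ x, 0 ≤ gu x) (pv : ∀ x, 0 ≤ gv x) (ps : ∀ x, 0 ≤ gs x)
    (hu : ν.map Prod.fst = volume.withDensity (fun x => ENNReal.ofReal (gu x)))
    (hv : ν.map Prod.snd = volume.withDensity (fun x => ENNReal.ofReal (gv x)))
    (hs : ν.map (fun z => z.1 + z.2) = volume.withDensity (fun x => ENNReal.ofReal (gs x))) :
    sqrtInfRenyiPower1 gs ≤ sqrtInfRenyiPower1 gu + sqrtInfRenyiPower1 gv := by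
  have hc : BzConv 2 (bzD ν volume) := by
    have := bz_conv_D (μ := volume) hν
    simpa using this
  have hD : bzD ν volume =ᵐ[volume] ν.rnDeriv volume := bz_D_ae
  have hDev : ∀ z, bzD ν volume (-z) = bzD ν volume z := bz_D_even hev
  have mpswap : MeasurePreserving (Prod.swap : ℝ × ℝ → ℝ × ℝ) volume volume :=
    Measure.measurePreserving_swap
  obtain ⟨u1, u2⟩ := bz_side hac LinearMap.id (MeasurePreserving.id _) measurable_fst
    (fun z => rfl) mu pu hu hD hc hDev
  have mpv : MeasurePreserving ((-LinearMap.snd ℝ ℝ ℝ).prod (LinearMap.fst ℝ ℝ ℝ)) volume volume := by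
    have := ((Measure.measurePreserving_neg (volume : Measure ℝ)).prod
      (MeasurePreserving.id (volume : Measure ℝ))).comp mpswap
    exact this
  obtain ⟨v1, v2⟩ := bz_side hac _ mpv measurable_snd (fun z => rfl) mv pv hv hD hc hDev
  have mps : MeasurePreserving ((LinearMap.fst ℝ ℝ ℝ - LinearMap.snd ℝ ℝ ℝ).prod (LinearMap.snd ℝ ℝ ℝ))
      volume volume := by
    have h : MeasurePreserving (fun p : ℝ × ℝ => (id p.1, p.2 - p.1)) (volume.prod volume) (volume.prod volume) :=
      (MeasurePreserving.id (volume : Measure ℝ)).skew_product (g := fun a b => b - a) (by fun_prop)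
        (Filter.Eventually.of_forall fun a => (measurePreserving_sub_right (volume : Measure ℝ) a).map_eq)
    exact mpswap.comp (h.comp mpswap)
  obtain ⟨s1, s2⟩ := bz_side hac _ mps (measurable_fst.add measurable_snd) (fun z => by simp) ms ps hs hD hc hDev
  have key := bz_line hc hDev ((0, 1) : ℝ × ℝ) (-1, 0)
  have e1 : (LinearMap.id : ℝ × ℝ →ₗ[ℝ] ℝ × ℝ) (0, 1) = (0, 1) := rfl
  have e2 : ((-LinearMap.snd ℝ ℝ ℝ).prod (LinearMap.fst ℝ ℝ ℝ)) (0, 1) = (-1, 0) := by simp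
  have e3 : ((LinearMap.fst ℝ ℝ ℝ - LinearMap.snd ℝ ℝ ℝ).prod (LinearMap.snd ℝ ℝ ℝ)) (0, 1)
    = (0, 1) + (-1, 0) := by simp
  rw [e1] at u1 u2
  rw [e2] at v1 v2
  rw [e3] at s1 s2
  rw [u1, v1, s1, ← ENNReal.toReal_add u2 v2]
  exact ENNReal.toReal_mono (ENNReal.add_ne_top.2 ⟨u2, v2⟩) key

section bzDeg
variable {Ω : Type*} [MeasurableSpace Ω] {P : Measure Ω} [IsProbabilityMeasure P]

lemma bz_no_zero {U : Ω → ℝ} {g : ℝ → ℝ} (h : HasDensityFn1 P U g) (hU : ∀ ω, U ω = 0) : False := by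
  obtain ⟨h1, h2, h3, h4⟩ := h
  have a : (P.map U) {0} = 1 := by
    rw [Measure.map_apply h1 (measurableSet_singleton 0)]
    have : U ⁻¹' {0} = Set.univ := by ext ω; simp [hU]
    rw [this]; simp
  have b : (P.map U) {0} = 0 := by
    rw [h4]
    exact withDensity_absolutelyContinuous _ _ (by simp)
  rw [a] at b
  exact one_ne_zero b

lemma bz_scale_dens {U : Ω → ℝ} {g g' : ℝ → ℝ} {c : ℝ} (hc : c ≠ 0) (h : HasDensityFn1 P U g)
    (h' : HasDensityFn1 P (fun ω => c * U ω) g') :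
    eLpNorm g' ⊤ volume = ENNReal.ofReal |c⁻¹| * eLpNorm g ⊤ volume := by
  obtain ⟨h1, h2, h3, h4⟩ := h
  obtain ⟨h1', h2', h3', h4'⟩ := h'
  rw [bz_norm_top h3, bz_norm_top h3']
  have hme : MeasurableEmbedding (fun x : ℝ => c⁻¹ * x) :=
    (Homeomorph.mulLeft₀ c⁻¹ (inv_ne_zero hc)).measurableEmbedding
  have hk : ENNReal.ofReal |c⁻¹| ≠ 0 := by simp [hc]
  have hgc : Measurable fun x => ENNReal.ofReal (g (c⁻¹ * x)) :=
    (h2.comp (measurable_const_mul _)).ennreal_ofReal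
  have e1 : (fun x => ENNReal.ofReal (g' x)) =ᵐ[volume]
      fun x => ENNReal.ofReal |c⁻¹| * ENNReal.ofReal (g (c⁻¹ * x)) := by
    rw [← withDensity_eq_iff_of_sigmaFinite h2'.ennreal_ofReal.aemeasurable
      (hgc.const_mul _).aemeasurable, ← h4']
    ext S hS
    have e : P.map (fun ω => c * U ω) = (P.map U).map (fun x => c * x) := by
      rw [Measure.map_map (measurable_const_mul c) h1]; rfl
    rw [e, h4, Measure.map_apply (measurable_const_mul c) hS,
      withDensity_apply _ (measurable_const_mul c hS), withDensity_apply _ hS,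
      lintegral_const_mul _ hgc]
    have key : (volume : Measure ℝ) = ENNReal.ofReal |c⁻¹| • Measure.map (fun x => c⁻¹ * x) volume := by
      rw [Real.map_volume_mul_left (inv_ne_zero hc), smul_smul, ← ENNReal.ofReal_mul (abs_nonneg _),
        ← abs_mul, mul_inv_cancel₀ (inv_ne_zero hc)]
      simp
    conv_lhs => rw [key]
    rw [Measure.restrict_smul, lintegral_smul_measure,
      setLIntegral_map (measurable_const_mul c hS) h2.ennreal_ofReal (measurable_const_mul _)]
    congr 3
    ext x
    simp [hc]
  rw [essSup_congr_ae e1, ENNReal.essSup_const_mul]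
  congr 1
  have := hme.essSup_map_measure (μ := volume) (g := fun x => ENNReal.ofReal (g x)) 
  rw [Real.map_volume_mul_left (inv_ne_zero hc)] at this
  have hq : essSup (fun x => ENNReal.ofReal (g x)) (ENNReal.ofReal |c⁻¹⁻¹| • (volume : Measure ℝ)) =
      essSup (fun x => ENNReal.ofReal (g x)) volume := by
    simp only [essSup]
    rw [Measure.ae_ennreal_smul_measure_eq (by simp [hc])]
  rw [hq] at this
  exact this.symm

lemma bz_deg {U : Ω → ℝ} {gu gv gs : ℝ → ℝ} {c : ℝ} (hu : HasDensityFn1 P U gu)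
    (hv : HasDensityFn1 P (fun ω => c * U ω) gv) (hs : HasDensityFn1 P (fun ω => (1 + c) * U ω) gs) :
    sqrtInfRenyiPower1 gs ≤ sqrtInfRenyiPower1 gu + sqrtInfRenyiPower1 gv := by
  have hc : c ≠ 0 := by
    rintro rfl
    exact bz_no_zero hv (by simp)
  have hc' : 1 + c ≠ 0 := by
    intro h
    exact bz_no_zero hs (by simp [h])
  have e1 := bz_scale_dens hc hu hv
  have e2 := bz_scale_dens hc' hu hs
  unfold sqrtInfRenyiPower1
  rw [e1, e2, ENNReal.toReal_mul, ENNReal.toReal_mul, ENNReal.toReal_ofReal (abs_nonneg _),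
    ENNReal.toReal_ofReal (abs_nonneg _)]
  set N := (eLpNorm gu ⊤ volume).toReal with hN
  have hN0 : 0 ≤ N := ENNReal.toReal_nonneg
  rcases hN0.eq_or_lt with h | h
  · rw [← h]; simp
  · have p1 : 0 < |c⁻¹| := abs_pos.2 (inv_ne_zero hc)
    have p2 : 0 < |(1 + c)⁻¹| := abs_pos.2 (inv_ne_zero hc')
    rw [Real.exp_neg, Real.exp_neg, Real.exp_neg, Real.exp_log h, Real.exp_log (by positivity),
      Real.exp_log (by positivity), mul_inv, mul_inv, abs_inv, abs_inv, inv_inv, inv_inv]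
    have : |1 + c| ≤ 1 + |c| := by simpa using abs_add_le 1 c
    calc |1 + c| * N⁻¹ ≤ (1 + |c|) * N⁻¹ := by gcongr
      _ = _ := by ring

end bzDeg

theorem busemann_convex_measures {Ω : Type*} [MeasurableSpace Ω] {d : ℕ} (hd : 0 < d)
    (P : Measure Ω) [IsProbabilityMeasure P]
    (κ : EReal) (hκ : κ ≤ ((1 / (d : ℝ) : ℝ) : EReal))
    (X : Ω → (Fin d → ℝ)) (hX : Measurable X)
    (hsymm : Measure.map (fun x : Fin d → ℝ => -x) (Measure.map X P) = Measure.map X P)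
    (hconc : IsKappaConcave κ (Measure.map X P))
    (u v : Fin d → ℝ) (gu gv gs : ℝ → ℝ)
    (hgu : HasDensityFn1 P (fun ω => ∑ i, u i * X ω i) gu)
    (hgv : HasDensityFn1 P (fun ω => ∑ i, v i * X ω i) gv)
    (hgs : HasDensityFn1 P (fun ω => ∑ i, (u i + v i) * X ω i) gs) :
    sqrtInfRenyiPower1 gs ≤ sqrtInfRenyiPower1 gu + sqrtInfRenyiPower1 gv := by
  have : IsProbabilityMeasure (P.map X) := Measure.isProbabilityMeasure_map hX.aemeasurable
  let T : (Fin d → ℝ) →ₗ[ℝ] ℝ × ℝ :=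
    { toFun := fun x => (∑ i, u i * x i, ∑ i, v i * x i)
      map_add' := fun x y => by simp [mul_add, Finset.sum_add_distrib]
      map_smul' := fun c x => by simp [Finset.mul_sum, mul_left_comm] }
  have hTx : ∀ x, T x = (∑ i, u i * x i, ∑ i, v i * x i) := fun x => rfl
  have hTc : Continuous T := T.continuous_of_finiteDimensional
  have hTm : Measurable T := hTc.measurable
  by_cases hTs : Function.Surjective T
  · have hνp : IsProbabilityMeasure ((P.map X).map T) :=
      Measure.isProbabilityMeasure_map hTm.aemeasurable
    have hball := bz_ball_of_concave hconc T hTm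
    have hev := bz_even_map hsymm T hTm
    have hac : (P.map X).map T ≪ volume :=
      bz_ac hball hev (bz_span hconc.1 T hTm hTc hTs)
    have hmap : ∀ l : ℝ × ℝ → ℝ, Measurable l → ((P.map X).map T).map l = P.map (fun ω => l (T (X ω))) := by
      intro l hl
      rw [Measure.map_map hl hTm, Measure.map_map (hl.comp hTm) hX]
      rfl
    refine bz_surj hball hev hac hgu.2.1 hgv.2.1 hgs.2.1 hgu.2.2.1 hgv.2.2.1 hgs.2.2.1 ?_ ?_ ?_
    · rw [hmap _ measurable_fst]; exact hgu.2.2.2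
    · rw [hmap _ measurable_snd]; exact hgv.2.2.2
    · rw [hmap (fun z => z.1 + z.2) (measurable_fst.add measurable_snd), ← hgs.2.2.2]
      congr 1
      ext ω
      simp [hTx, add_mul, Finset.sum_add_distrib]
  · have hr : LinearMap.range T < ⊤ := lt_top_iff_ne_top.2 fun h => hTs (LinearMap.range_eq_top.1 h)
    obtain ⟨f, hf0, hf⟩ := Submodule.exists_le_ker_of_lt_top _ hr
    have hfz : ∀ z : ℝ × ℝ, f z = f (1, 0) * z.1 + f (0, 1) * z.2 := by
      rintro ⟨a, b⟩
      have : ((a, b) : ℝ × ℝ) = a • (1, 0) + b • (0, 1) := by simp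
      rw [this, map_add, map_smul, map_smul]
      simp [mul_comm]
    have hrel : ∀ ω, f (1, 0) * (∑ i, u i * X ω i) + f (0, 1) * (∑ i, v i * X ω i) = 0 := by
      intro ω
      have h1 : f (T (X ω)) = 0 := hf ⟨X ω, rfl⟩
      rw [hfz] at h1
      exact h1
    have hb : f (0, 1) ≠ 0 := by
      intro hb
      have ha : f (1, 0) ≠ 0 := by
        intro ha
        apply hf0
        ext <;> simp [ha, hb]
      refine bz_no_zero hgu fun ω => ?_
      have := hrel ω
      rw [hb, zero_mul, add_zero] at this
      exact (mul_eq_zero.1 this).resolve_left ha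
    have hV : ∀ ω, ∑ i, v i * X ω i = (-f (1, 0) / f (0, 1)) * ∑ i, u i * X ω i := by
      intro ω
      have := hrel ω
      field_simp
      linarith
    have eV : (fun ω => ∑ i, v i * X ω i) = fun ω => (-f (1, 0) / f (0, 1)) * ∑ i, u i * X ω i :=
      funext hV
    have eS : (fun ω => ∑ i, (u i + v i) * X ω i) =
        fun ω => (1 + -f (1, 0) / f (0, 1)) * ∑ i, u i * X ω i := by
      ext ω
      rw [add_mul, ← hV, one_mul, ← Finset.sum_add_distrib]
      simp [add_mul]
    rw [eV] at hgv
    rw [eS] at hgs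
    exact bz_deg hgu hgv hgs
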